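/- Let k and a be integers with 0 < a < k, and let y = 2^{k+1}−2^a−1. Then (x,z) ∈ Ulam[y] if and only if at least one of the following holds, where x' = x mod 2^{k+1} and z' = z mod 2^{k+1}: (i) x+z = y and (x mod 2^{a+1}) < 2^a; (ii) x' + z' = 2^{k+1}−1; (iii) x' + z' = 2^{k+1}+2^a−1. -/

import Mathlib

/-- Fuel-indexed Ulam predicate: a binary word (as a `List Bool`) of length 1 is Ulam,
and a longer word is Ulam iff it is expressible *uniquely* as a concatenation of two
distinct (nonempty) Ulam words. The fuel strictly exceeds the lengths needed. -/
def ulamAux : ℕ → List Bool → Prop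
  | 0, _ => False
  | n + 1, w =>
    if w.length = 1 then True
    else ∃! p : List Bool × List Bool,
      p.1 ≠ [] ∧ p.2 ≠ [] ∧ p.1 ≠ p.2 ∧ w = p.1 ++ p.2 ∧
        ulamAux n p.1 ∧ ulamAux n p.2

/-- A binary word is an Ulam word. -/
def IsUlam (w : List Bool) : Prop := ulamAux w.length w

/-- The word `0^x 1 0^y`. -/
def wordTwo (x y : ℕ) : List Bool :=
  List.replicate x false ++ [true] ++ List.replicate y false

/-- The word `0^x 1 0^y 1 0^z`. -/
def wordThree (x y z : ℕ) : List Bool :=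
  List.replicate x false ++ [true] ++ List.replicate y false ++ [true] ++
    List.replicate z false

/-- `UlamSet y` is the set of pairs `(x,z)` such that `0^x 1 0^y 1 0^z` is Ulam. -/
def UlamSet (y : ℕ) : Set (ℕ × ℕ) := {p | IsUlam (wordThree p.1 y p.2)}

/-- `culam y x z = min(2, N)` where `N` counts `0 ≤ a ≤ y` with both
`w(x,a)` and `w(y-a,z)` Ulam. -/
noncomputable def culam (y x z : ℕ) : ℕ :=
  min 2 {a : ℕ | a ≤ y ∧ IsUlam (wordTwo x a) ∧ IsUlam (wordTwo (y - a) z)}.ncard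

/-- A positive integer is Zumkeller if its binary representation has at most one `0`. -/
def IsZumkeller (y : ℕ) : Prop := 0 < y ∧ (Nat.bits y).count false ≤ 1

/-- The largest `e ≤ d - 1` with `x mod 2^(e+1) < 2^e` and `z mod 2^(e+1) < 2^e`
(and `0` if none exists). -/
def eIdx (d x z : ℕ) : ℕ :=
  Nat.findGreatest (fun e => x % 2 ^ (e + 1) < 2 ^ e ∧ z % 2 ^ (e + 1) < 2 ^ e) (d - 1)

/-- The universal pattern `E1[d]` on `B_d`. -/
def E1 (d x z : ℕ) : ℕ :=
  if 2 ^ d - 1 ≤ x + z then 0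
  else if x % 2 ^ eIdx d x z + z % 2 ^ eIdx d x z < 2 ^ eIdx d x z - 1 then 2 else 1

/-- The universal pattern `E2[d]` on `B_d` (constant `1`). -/
def E2 (_d _x _z : ℕ) : ℕ := 1

/-- The universal pattern `O1[d]` on `B_d`. -/
def O1 (d x z : ℕ) : ℕ :=
  if 2 ^ d - 2 ≤ x + z then 0
  else if (x + z) % 2 = 0 then (if x % 2 = 1 then 0 else 2)
  else if x % 2 ^ eIdx d x z + z % 2 ^ eIdx d x z < 2 ^ eIdx d x z - 1 then 2 else 1

/-- The universal pattern `O2[d]` on `B_d` (independent of `d`). -/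
def O2 (_d x z : ℕ) : ℕ :=
  if (x + z) % 2 = 0 then (if x % 2 = 1 then 0 else 2) else 1
/-! ### Unfolding the fuel -/

theorem ulamAux_fuel_irrel (n m : ℕ) (w : List Bool) (hn : w.length ≤ n) (hm : w.length ≤ m) :
    ulamAux n w ↔ ulamAux m w := by
  have nil_false : ∀ k, ¬ ulamAux k [] := by
    rintro (_ | k)
    · simp [ulamAux]
    · rintro h
      simp only [ulamAux, List.length_nil] at h
      obtain ⟨p, ⟨h1, _, _, h4, _⟩, _⟩ := h
      simp at h4
      exact h1 h4.1
  induction n generalizing m w with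
  | zero =>
    obtain rfl : w = [] := by simpa using hn
    simp [nil_false]
  | succ n ih =>
    rcases m with _ | m
    · obtain rfl : w = [] := by simpa using hm
      simp [nil_false]
    · simp only [ulamAux]
      split
      · rfl
      · refine existsUnique_congr fun p => ?_
        refine and_congr_right fun h1 => and_congr_right fun h2 => and_congr_right fun _ =>
          and_congr_right fun h4 => ?_
        have l1 := List.length_pos_iff.mpr h1
        have l2 := List.length_pos_iff.mpr h2
        rw [h4, List.length_append] at hn hm
        exact and_congr (ih m p.1 (by omega) (by omega)) (ih m p.2 (by omega) (by omega))

theorem isUlam_of_length_one {w : List Bool} (h : w.length = 1) : IsUlam w := by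
  simp [IsUlam, h, ulamAux]

theorem isUlam_iff {w : List Bool} (h : w.length ≠ 1) :
    IsUlam w ↔ ∃! p : List Bool × List Bool,
      p.1 ≠ [] ∧ p.2 ≠ [] ∧ p.1 ≠ p.2 ∧ w = p.1 ++ p.2 ∧ IsUlam p.1 ∧ IsUlam p.2 := by
  rw [IsUlam, ulamAux_fuel_irrel _ (w.length + 1) w le_rfl (by omega), ulamAux, if_neg h]
  refine existsUnique_congr fun p => ?_
  refine and_congr_right fun _ => and_congr_right fun _ => and_congr_right fun _ =>
    and_congr_right fun h4 => ?_
  rw [IsUlam, IsUlam, ulamAux_fuel_irrel w.length _ p.1 (by simp [h4]) le_rfl,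
    ulamAux_fuel_irrel w.length _ p.2 (by simp [h4]) le_rfl]

theorem isUlam_replicate_false (n : ℕ) : IsUlam (List.replicate n false) ↔ n = 1 := by
  induction n using Nat.strong_induction_on with
  | _ n ih =>
    refine ⟨fun h => ?_, fun h => isUlam_of_length_one (by simp [h])⟩
    by_contra hn
    rw [isUlam_iff (by simpa using hn)] at h
    obtain ⟨⟨u, v⟩, ⟨h1, h2, h3, h4, h5, h6⟩, _⟩ := h
    obtain ⟨hl, hu, hv⟩ := List.append_eq_replicate_iff.mp h4.symm
    dsimp only at *
    have l1 := List.length_pos_iff.mpr h1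
    have l2 := List.length_pos_iff.mpr h2
    rw [hu, ih _ (by omega)] at h5
    rw [hv, ih _ (by omega)] at h6
    exact h3 (by rw [hu, hv, h5, h6])

/-! ### Splitting words -/

theorem replicate_append_true_eq_append {x : ℕ} {B u v : List Bool} :
    List.replicate x false ++ true :: B = u ++ v ↔
      (∃ i ≤ x, u = List.replicate i false ∧ v = List.replicate (x - i) false ++ true :: B) ∨
      ∃ u', u = List.replicate x false ++ true :: u' ∧ B = u' ++ v := by
  induction x generalizing u with
  | zero =>
    rcases u with _ | ⟨c, u⟩
    · simp only [List.replicate_zero, List.nil_append]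
      constructor
      · rintro rfl
        exact Or.inl ⟨0, le_rfl, rfl, rfl⟩
      · rintro (⟨i, _, _, rfl⟩ | ⟨u', hu, _⟩)
        · simp
        · simp at hu
    · simp only [List.replicate_zero, List.nil_append, List.cons_append, List.cons.injEq]
      constructor
      · rintro ⟨rfl, rfl⟩
        exact Or.inr ⟨u, ⟨rfl, rfl⟩, rfl⟩
      · rintro (⟨i, hi, hu, _⟩ | ⟨u', ⟨rfl, rfl⟩, rfl⟩)
        · obtain rfl : i = 0 := by omega
          simp at hu
        · exact ⟨rfl, rfl⟩
  | succ x ih =>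
    rcases u with _ | ⟨c, u⟩
    · simp only [List.nil_append]
      constructor
      · rintro rfl
        exact Or.inl ⟨0, by omega, rfl, rfl⟩
      · rintro (⟨i, _, hi, rfl⟩ | ⟨u', hu, _⟩)
        · obtain rfl : i = 0 := by
            rcases i with _ | i
            · rfl
            · simp [List.replicate_succ] at hi
          rfl
        · simp [List.replicate_succ] at hu
    · simp only [List.replicate_succ, List.cons_append, List.cons.injEq, ih]
      constructor
      · rintro ⟨rfl, ⟨i, hi, rfl, rfl⟩ | ⟨u', rfl, rfl⟩⟩
        · exact Or.inl ⟨i + 1, by omega, List.replicate_succ.symm, by simp⟩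
        · exact Or.inr ⟨u', by simp, rfl⟩
      · rintro (⟨i, hi, hu, rfl⟩ | ⟨u', ⟨rfl, rfl⟩, rfl⟩)
        · rcases i with _ | i
          · simp at hu
          · simp only [List.replicate_succ, List.cons.injEq] at hu
            exact ⟨hu.1.symm, Or.inl ⟨i, by omega, hu.2, by simp⟩⟩
        · exact ⟨rfl, Or.inr ⟨u', rfl, rfl⟩⟩

theorem wordTwo_eq (x y : ℕ) :
    wordTwo x y = List.replicate x false ++ true :: List.replicate y false := by
  simp [wordTwo]

theorem wordThree_eq (x y z : ℕ) :
    wordThree x y z = List.replicate x false ++ true :: wordTwo y z := by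
  simp [wordThree, wordTwo]

theorem wordTwo_inj {x y x' y' : ℕ} : wordTwo x y = wordTwo x' y' ↔ x = x' ∧ y = y' := by
  refine ⟨fun h => ?_, fun h => by rw [h.1, h.2]⟩
  have hl : x + y = x' + y' := by
    have := congrArg List.length h
    simp [wordTwo] at this
    omega
  have hx : ∀ x y, (wordTwo x y).idxOf true = x := by
    intro x y
    rw [wordTwo_eq]
    induction x with
    | zero => simp
    | succ x ih => rw [List.replicate_succ, List.cons_append, List.idxOf_cons_ne _ (by simp), ih]
  have := congrArg (List.idxOf true) h
  rw [hx, hx] at this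
  omega

theorem wordTwo_split {x y : ℕ} {u v : List Bool} (hu : u ≠ []) (hv : v ≠ [])
    (hU : IsUlam u) (hV : IsUlam v) (h : wordTwo x y = u ++ v) :
    (1 ≤ x ∧ u = [false] ∧ v = wordTwo (x - 1) y) ∨
      (1 ≤ y ∧ u = wordTwo x (y - 1) ∧ v = [false]) := by
  rw [wordTwo_eq, replicate_append_true_eq_append] at h
  rcases h with ⟨i, hi, rfl, rfl⟩ | ⟨u', rfl, h⟩
  · rw [isUlam_replicate_false] at hU
    subst hU
    exact Or.inl ⟨hi, rfl, (wordTwo_eq _ _).symm⟩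
  · obtain ⟨hl, hu', hv'⟩ := List.append_eq_replicate_iff.mp h.symm
    rw [hv', isUlam_replicate_false] at hV
    rw [hV] at hv' hl
    refine Or.inr ⟨by omega, ?_, hv'⟩
    rw [wordTwo_eq, hu']
    congr 3
    omega

theorem wordThree_split {x y z : ℕ} {u v : List Bool}
    (hU : IsUlam u) (hV : IsUlam v) (h : wordThree x y z = u ++ v) :
    (1 ≤ x ∧ u = [false] ∧ v = wordThree (x - 1) y z) ∨
      (1 ≤ z ∧ u = wordThree x y (z - 1) ∧ v = [false]) ∨
      ∃ t ≤ y, u = wordTwo x t ∧ v = wordTwo (y - t) z := by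
  rw [wordThree_eq, replicate_append_true_eq_append] at h
  rcases h with ⟨i, hi, rfl, rfl⟩ | ⟨u', rfl, h⟩
  · rw [isUlam_replicate_false] at hU
    subst hU
    exact Or.inl ⟨hi, rfl, (wordThree_eq _ _ _).symm⟩
  · rw [wordTwo_eq, replicate_append_true_eq_append] at h
    rcases h with ⟨i, hi, rfl, rfl⟩ | ⟨u'', rfl, h⟩
    · exact Or.inr (Or.inr ⟨i, hi, (wordTwo_eq _ _).symm, (wordTwo_eq _ _).symm⟩)
    · obtain ⟨hl, hu', hv'⟩ := List.append_eq_replicate_iff.mp h.symm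
      rw [hv', isUlam_replicate_false] at hV
      rw [hV] at hv' hl
      refine Or.inr (Or.inl ⟨by omega, ?_, hv'⟩)
      rw [wordThree_eq, wordTwo_eq, hu']
      congr 5
      omega

theorem false_cons_wordTwo {x y : ℕ} (hx : 1 ≤ x) :
    [false] ++ wordTwo (x - 1) y = wordTwo x y := by
  obtain ⟨x, rfl⟩ := Nat.exists_eq_add_of_le' hx
  simp [wordTwo, List.replicate_succ]

theorem wordTwo_append_false {x y : ℕ} (hy : 1 ≤ y) :
    wordTwo x (y - 1) ++ [false] = wordTwo x y := by
  obtain ⟨y, rfl⟩ := Nat.exists_eq_add_of_le' hy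
  simp [wordTwo, List.replicate_succ']

theorem false_cons_wordThree {x y z : ℕ} (hx : 1 ≤ x) :
    [false] ++ wordThree (x - 1) y z = wordThree x y z := by
  obtain ⟨x, rfl⟩ := Nat.exists_eq_add_of_le' hx
  simp [wordThree, List.replicate_succ]

theorem wordThree_append_false {x y z : ℕ} (hz : 1 ≤ z) :
    wordThree x y (z - 1) ++ [false] = wordThree x y z := by
  obtain ⟨z, rfl⟩ := Nat.exists_eq_add_of_le' hz
  simp [wordThree, List.replicate_succ']

theorem wordTwo_append_wordTwo {x y z t : ℕ} (ht : t ≤ y) :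
    wordTwo x t ++ wordTwo (y - t) z = wordThree x y z := by
  rw [wordThree_eq, wordTwo_eq, wordTwo_eq, wordTwo_eq]
  obtain ⟨s, rfl⟩ := Nat.exists_eq_add_of_le ht
  rw [List.replicate_add t s, Nat.add_sub_cancel_left]
  simp only [List.append_assoc, List.cons_append]

theorem count_wordTwo (x y : ℕ) : (wordTwo x y).count true = 1 := by
  simp [wordTwo, List.count_replicate]

theorem count_wordThree (x y z : ℕ) : (wordThree x y z).count true = 2 := by
  simp [wordThree, List.count_replicate]

theorem ne_nil_of_count_ne_zero {w : List Bool} (h : w.count true ≠ 0) : w ≠ [] := by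
  rintro rfl
  simp at h

theorem ne_of_count_ne {u v : List Bool} (h : u.count true ≠ v.count true) : u ≠ v :=
  fun e => h (by rw [e])

/-- Unique existence over a disjoint union of two optional points and an injective family. -/
theorem existsUnique_iff_count {α : Type*} {A B : Prop} [Decidable A] [Decidable B] {a b : α}
    {s : Finset ℕ} {f : ℕ → α} (hab : a ≠ b) (ha : ∀ t ∈ s, f t ≠ a)
    (hb : ∀ t ∈ s, f t ≠ b) (hf : Set.InjOn f s) :
    (∃! p, (A ∧ p = a) ∨ (B ∧ p = b) ∨ ∃ t ∈ s, p = f t) ↔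
      (if A then 1 else 0) + (if B then 1 else 0) + s.card = 1 := by
  classical
  let S : Finset α := ((if A then {a} else ∅) ∪ (if B then {b} else ∅)) ∪ s.image f
  have hS : ∀ p, p ∈ S ↔ (A ∧ p = a) ∨ (B ∧ p = b) ∨ ∃ t ∈ s, p = f t := by
    intro p
    simp only [S]
    by_cases hA : A <;> by_cases hB : B <;> simp [hA, hB, eq_comm]
  have hc : S.card = (if A then 1 else 0) + (if B then 1 else 0) + s.card := by
    simp only [S]
    rw [Finset.card_union_of_disjoint, Finset.card_union_of_disjoint,
      Finset.card_image_of_injOn hf]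
    · by_cases hA : A <;> by_cases hB : B <;> simp [hA, hB]
    · by_cases hA : A <;> by_cases hB : B <;> simp [hA, hB, hab]
    · rw [Finset.disjoint_left]
      intro p hp hp'
      obtain ⟨t, ht, rfl⟩ := Finset.mem_image.mp hp'
      by_cases hA : A <;> by_cases hB : B <;> simp [hA, hB, ha t ht, hb t ht] at hp
  rw [← hc, Finset.card_eq_one, Finset.singleton_iff_unique_mem]
  exact existsUnique_congr fun p => (hS p).symm

/-! ### Words with a single `1` -/

/-- The indicator of `w(x,y)` being Ulam: a binomial coefficient modulo `2`. -/
def binomParity (x y : ℕ) : ℕ := (x + y).choose x % 2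

theorem binomParity_comm (x y : ℕ) : binomParity x y = binomParity y x := by
  rw [binomParity, binomParity, Nat.choose_symm_add, add_comm]

theorem binomParity_zero_left (y : ℕ) : binomParity 0 y = 1 := by simp [binomParity]

theorem binomParity_zero_right (x : ℕ) : binomParity x 0 = 1 := by simp [binomParity]

theorem binomParity_lt_two (x y : ℕ) : binomParity x y < 2 := Nat.mod_lt _ (by norm_num)

theorem binomParity_pascal (x y : ℕ) (h : x + y ≠ 0) :
    binomParity x y = 1 ↔ (if 1 ≤ x ∧ binomParity (x - 1) y = 1 then 1 else 0) +
      (if 1 ≤ y ∧ binomParity x (y - 1) = 1 then 1 else 0) = 1 := by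
  rcases x with _ | x
  · rcases y with _ | y
    · simp at h
    · simp [binomParity_zero_left]
  · rcases y with _ | y
    · simp [binomParity_zero_right]
    · have key : (x + 1 + (y + 1)).choose (x + 1) =
          (x + (y + 1)).choose x + (x + 1 + y).choose (x + 1) := by
        rw [show x + 1 + (y + 1) = (x + (y + 1)) + 1 by ring, Nat.choose_succ_succ]
        congr 2
        ring
      simp only [binomParity, key, Nat.add_sub_cancel]
      have h1 := Nat.mod_two_eq_zero_or_one ((x + (y + 1)).choose x)
      have h2 := Nat.mod_two_eq_zero_or_one ((x + 1 + y).choose (x + 1))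
      rcases h1 with h1 | h1 <;> rcases h2 with h2 | h2 <;>
        simp [h1, h2, Nat.add_mod]

theorem isUlam_wordTwo (x y : ℕ) : IsUlam (wordTwo x y) ↔ binomParity x y = 1 := by
  induction hn : x + y using Nat.strong_induction_on generalizing x y with
  | _ n ih =>
    by_cases h0 : x + y = 0
    · obtain ⟨rfl, rfl⟩ : x = 0 ∧ y = 0 := by omega
      exact ⟨fun _ => binomParity_zero_left 0, fun _ => isUlam_of_length_one (by simp [wordTwo])⟩
    · rw [isUlam_iff (by simp [wordTwo]; omega), binomParity_pascal x y h0]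
      have hc := existsUnique_iff_count (A := 1 ≤ x ∧ binomParity (x - 1) y = 1)
        (B := 1 ≤ y ∧ binomParity x (y - 1) = 1) (a := ([false], wordTwo (x - 1) y))
        (b := (wordTwo x (y - 1), [false])) (s := ∅) (f := fun _ => ([], []))
        (fun h => ne_of_count_ne (by simp [count_wordTwo]) (congrArg Prod.fst h))
        (by simp) (by simp) (by simp)
      rw [Finset.card_empty, add_zero] at hc
      rw [← hc]
      refine existsUnique_congr ?_
      rintro ⟨u, v⟩
      constructor
      · rintro ⟨hu, hv, -, h, hU, hV⟩
        rcases wordTwo_split hu hv hU hV h with ⟨hx, rfl, rfl⟩ | ⟨hy, rfl, rfl⟩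
        · exact Or.inl ⟨⟨hx, (ih _ (by omega) _ _ rfl).mp hV⟩, rfl⟩
        · exact Or.inr (Or.inl ⟨⟨hy, (ih _ (by omega) _ _ rfl).mp hU⟩, rfl⟩)
      · have hne : ∀ p q, wordTwo p q ≠ [] := fun p q => ne_nil_of_count_ne_zero (by
          simp [count_wordTwo])
        have hne' : ∀ p q, wordTwo p q ≠ [false] := fun p q => ne_of_count_ne (by
          simp [count_wordTwo])
        rintro (⟨⟨hx, hb⟩, h⟩ | ⟨⟨hy, hb⟩, h⟩ | ⟨t, ht, _⟩)
        · obtain ⟨rfl, rfl⟩ := Prod.mk.inj h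
          exact ⟨by simp, hne _ _, (hne' _ _).symm, (false_cons_wordTwo hx).symm,
            isUlam_of_length_one rfl, (ih _ (by omega) _ _ rfl).mpr hb⟩
        · obtain ⟨rfl, rfl⟩ := Prod.mk.inj h
          exact ⟨hne _ _, by simp, hne' _ _, (wordTwo_append_false hy).symm,
            (ih _ (by omega) _ _ rfl).mpr hb, isUlam_of_length_one rfl⟩
        · simp at ht

/-! ### The recurrence for words with two `1`s -/

/-- The number of ways to write `0^x 1 0^y 1 0^z` as a product of two Ulam words with a single
`1` each, the factors being allowed to coincide. -/
def innerCount (y x z : ℕ) : ℕ :=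
  ∑ t ∈ Finset.range (y + 1), binomParity x t * binomParity (y - t) z

open Classical in
theorem mem_ulamSet_iff (y x z : ℕ) :
    (x, z) ∈ UlamSet y ↔
      (if 1 ≤ x ∧ (x - 1, z) ∈ UlamSet y then 1 else 0) +
        (if 1 ≤ z ∧ (x, z - 1) ∈ UlamSet y then 1 else 0) +
        (innerCount y x z - if x + z = y then binomParity x z else 0) = 1 := by
  set s₀ := (Finset.range (y + 1)).filter
    fun t => binomParity x t = 1 ∧ binomParity (y - t) z = 1 with hs₀
  set s := s₀.filter fun t => ¬ (x = y - t ∧ t = z) with hs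
  have hs₀c : s₀.card = innerCount y x z := by
    rw [hs₀, Finset.card_filter, innerCount]
    refine Finset.sum_congr rfl fun t _ => ?_
    have h1 := binomParity_lt_two x t
    have h2 := binomParity_lt_two (y - t) z
    interval_cases binomParity x t <;> interval_cases binomParity (y - t) z <;> simp
  have hsc : s.card = innerCount y x z - if x + z = y then binomParity x z else 0 := by
    rw [← hs₀c]
    by_cases hxz : x + z = y
    · have : s = s₀.erase z := by
        ext t
        simp only [hs, hs₀, Finset.mem_filter, Finset.mem_erase, Finset.mem_range]
        constructor
        · rintro ⟨h1, h2⟩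
          exact ⟨fun e => h2 ⟨by omega, e⟩, h1⟩
        · rintro ⟨h1, h2⟩
          exact ⟨h2, fun e => h1 e.2⟩
      rw [this, if_pos hxz]
      have hb := binomParity_lt_two x z
      by_cases h : binomParity x z = 1
      · rw [Finset.card_erase_of_mem, h]
        simp only [hs₀, Finset.mem_filter, Finset.mem_range]
        rw [show y - z = x by omega]
        exact ⟨by omega, h, h⟩
      · rw [Finset.erase_eq_of_notMem]
        · omega
        · simp [hs₀, h]
    · rw [if_neg hxz, hs, Finset.filter_true_of_mem]
      · simp
      · intro t ht
        simp only [hs₀, Finset.mem_filter, Finset.mem_range] at ht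
        omega
  have hmem : ∀ t, t ∈ s ↔ t ≤ y ∧ binomParity x t = 1 ∧ binomParity (y - t) z = 1 ∧
      ¬ (x = y - t ∧ t = z) := by
    intro t
    simp only [hs, hs₀, Finset.mem_filter, Finset.mem_range]
    rw [Nat.lt_succ_iff]
    tauto
  rw [← hsc, ← existsUnique_iff_count (a := ([false], wordThree (x - 1) y z))
    (b := (wordThree x y (z - 1), [false])) (f := fun t => (wordTwo x t, wordTwo (y - t) z))]
  · rw [UlamSet, Set.mem_ofPred_eq, isUlam_iff (by simp [wordThree]; omega)]
    refine existsUnique_congr ?_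
    rintro ⟨u, v⟩
    constructor
    · rintro ⟨hu, hv, hne, h, hU, hV⟩
      rcases wordThree_split hU hV h with ⟨hx, rfl, rfl⟩ | ⟨hz, rfl, rfl⟩ | ⟨t, ht, rfl, rfl⟩
      · exact Or.inl ⟨⟨hx, hV⟩, rfl⟩
      · exact Or.inr (Or.inl ⟨⟨hz, hU⟩, rfl⟩)
      · refine Or.inr (Or.inr ⟨t, (hmem t).mpr ⟨ht, (isUlam_wordTwo _ _).mp hU,
          (isUlam_wordTwo _ _).mp hV, fun e => hne ?_⟩, rfl⟩)
        exact wordTwo_inj.mpr e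
    · rintro (⟨⟨hx, hb⟩, h⟩ | ⟨⟨hy, hb⟩, h⟩ | ⟨t, ht, h⟩)
      · obtain ⟨rfl, rfl⟩ := Prod.mk.inj h
        exact ⟨by simp, ne_nil_of_count_ne_zero (by simp [count_wordThree]),
          ne_of_count_ne (by simp [count_wordThree]), (false_cons_wordThree hx).symm,
          isUlam_of_length_one rfl, hb⟩
      · obtain ⟨rfl, rfl⟩ := Prod.mk.inj h
        exact ⟨ne_nil_of_count_ne_zero (by simp [count_wordThree]), by simp,
          ne_of_count_ne (by simp [count_wordThree]), (wordThree_append_false hy).symm,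
          hb, isUlam_of_length_one rfl⟩
      · obtain ⟨rfl, rfl⟩ := Prod.mk.inj h
        obtain ⟨hty, h1, h2, h3⟩ := (hmem t).mp ht
        exact ⟨ne_nil_of_count_ne_zero (by simp [count_wordTwo]),
          ne_nil_of_count_ne_zero (by simp [count_wordTwo]), fun e => h3 (wordTwo_inj.mp e),
          (wordTwo_append_wordTwo hty).symm, (isUlam_wordTwo _ _).mpr h1,
          (isUlam_wordTwo _ _).mpr h2⟩
  · exact fun h => ne_of_count_ne (by simp [count_wordThree]) (congrArg Prod.fst h)
  · exact fun t _ h => ne_of_count_ne (by simp [count_wordTwo]) (congrArg Prod.fst h)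
  · exact fun t _ h => ne_of_count_ne (by simp [count_wordTwo, count_wordThree])
      (congrArg Prod.fst h)
  · exact fun t _ t' _ h => (wordTwo_inj.mp (congrArg Prod.fst h)).2

/-! ### Halving -/

theorem binomParity_halve (x y : ℕ) :
    binomParity x y = (1 - (x % 2) * (y % 2)) * binomParity (x / 2) (y / 2) := by
  have := Fact.mk Nat.prime_two
  have h := Choose.choose_modEq_choose_mod_mul_choose_div_nat (n := x + y) (k := x) (p := 2)
  rw [Nat.ModEq] at h
  rw [binomParity, h, binomParity]
  rcases Nat.mod_two_eq_zero_or_one x with hx | hx <;>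
    rcases Nat.mod_two_eq_zero_or_one y with hy | hy
  · rw [show (x + y) / 2 = x / 2 + y / 2 by omega, show (x + y) % 2 = 0 by omega, hx, hy]
    simp
  · rw [show (x + y) / 2 = x / 2 + y / 2 by omega, show (x + y) % 2 = 1 by omega, hx, hy]
    simp
  · rw [show (x + y) / 2 = x / 2 + y / 2 by omega, show (x + y) % 2 = 1 by omega, hx, hy]
    simp
  · rw [show (x + y) % 2 = 0 by omega, hx, hy]
    simp

theorem sum_range_two_mul (f : ℕ → ℕ) (n : ℕ) :
    ∑ t ∈ Finset.range (2 * n), f t = ∑ i ∈ Finset.range n, (f (2 * i) + f (2 * i + 1)) := by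
  induction n with
  | zero => simp
  | succ n ih =>
    rw [show 2 * (n + 1) = 2 * n + 1 + 1 by ring, Finset.sum_range_succ, Finset.sum_range_succ,
      Finset.sum_range_succ, ih]
    ring

theorem binomParity_even_right (x y : ℕ) : binomParity x (2 * y) = binomParity (x / 2) y := by
  rw [binomParity_halve]
  simp

theorem binomParity_odd_right (x y : ℕ) :
    binomParity x (2 * y + 1) = (1 - x % 2) * binomParity (x / 2) y := by
  rw [binomParity_halve, show (2 * y + 1) % 2 = 1 by omega, show (2 * y + 1) / 2 = y by omega]
  simp

theorem binomParity_even_left (x y : ℕ) : binomParity (2 * x) y = binomParity x (y / 2) := by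
  rw [binomParity_comm, binomParity_even_right, binomParity_comm]

theorem binomParity_odd_left (x y : ℕ) :
    binomParity (2 * x + 1) y = (1 - y % 2) * binomParity x (y / 2) := by
  rw [binomParity_comm, binomParity_odd_right, binomParity_comm]

theorem innerCount_zero (x z : ℕ) : innerCount 0 x z = 1 := by
  simp [innerCount, binomParity_zero_left, binomParity_zero_right]

theorem innerCount_odd (m x z : ℕ) :
    innerCount (2 * m + 1) x z =
      ((1 - x % 2) + (1 - z % 2)) * innerCount m (x / 2) (z / 2) := by
  rw [innerCount, innerCount, show 2 * m + 1 + 1 = 2 * (m + 1) by ring, sum_range_two_mul,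
    Finset.mul_sum]
  refine Finset.sum_congr rfl fun i hi => ?_
  have hi' := Finset.mem_range.mp hi
  rw [binomParity_even_right, binomParity_odd_right,
    show 2 * m + 1 - 2 * i = 2 * (m - i) + 1 by omega,
    show 2 * m + 1 - (2 * i + 1) = 2 * (m - i) by omega,
    binomParity_even_left, binomParity_odd_left]
  ring

theorem innerCount_even (m x z : ℕ) :
    innerCount (2 * m + 2) x z = innerCount (m + 1) (x / 2) (z / 2) +
      (1 - x % 2) * (1 - z % 2) * innerCount m (x / 2) (z / 2) := by
  rw [innerCount, innerCount, innerCount, show 2 * m + 2 + 1 = 2 * (m + 1) + 1 by ring,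
    Finset.sum_range_succ, Finset.sum_range_succ _ (m + 1), sum_range_two_mul,
    Finset.sum_add_distrib, Finset.mul_sum, binomParity_even_right, ← Nat.mul_succ,
    Nat.sub_self, Nat.sub_self, binomParity_zero_left, binomParity_zero_left]
  have h1 : ∀ i ∈ Finset.range (m + 1),
      binomParity x (2 * i) * binomParity (2 * m.succ - 2 * i) z =
        binomParity (x / 2) i * binomParity (m + 1 - i) (z / 2) := by
    intro i hi
    rw [binomParity_even_right, ← Nat.mul_sub, binomParity_even_left]
  have h2 : ∀ i ∈ Finset.range (m + 1),
      binomParity x (2 * i + 1) * binomParity (2 * m.succ - (2 * i + 1)) z =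
        (1 - x % 2) * (1 - z % 2) * (binomParity (x / 2) i * binomParity (m - i) (z / 2)) := by
    intro i hi
    have hi' := Finset.mem_range.mp hi
    rw [binomParity_odd_right, show 2 * m.succ - (2 * i + 1) = 2 * (m - i) + 1 by omega,
      binomParity_odd_left]
    ring
  rw [Finset.sum_congr rfl h1, Finset.sum_congr rfl h2]
  ring

theorem innerCount_comm (y x z : ℕ) : innerCount y x z = innerCount y z x := by
  rw [innerCount, innerCount, ← Finset.sum_range_reflect]
  refine Finset.sum_congr rfl fun i hi => ?_
  have hi' := Finset.mem_range.mp hi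
  rw [binomParity_comm x, binomParity_comm _ z, mul_comm]
  congr 2; omega

theorem mod_two_pow_succ (x h : ℕ) : x % 2 ^ (h + 1) = 2 * (x / 2 % 2 ^ h) + x % 2 := by
  rw [pow_succ', Nat.mod_mul, add_comm]

/-! ### Counting decompositions for particular `y` -/

theorem innerCount_pos_of_mod_eq_zero (h x z : ℕ) {y : ℕ} (hy : y < 2 ^ h)
    (hx : x % 2 ^ h = 0) : 0 < innerCount y x z := by
  have key : binomParity x y = 1 := by
    induction h generalizing x y with
    | zero =>
      obtain rfl : y = 0 := by simpa using hy
      exact binomParity_zero_right x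
    | succ h ih =>
      rw [mod_two_pow_succ] at hx
      rw [pow_succ] at hy
      rw [binomParity_halve, ih (x / 2) (y := y / 2) (by omega) (by omega),
        show x % 2 = 0 by omega]
      simp
  rw [innerCount]
  refine Finset.sum_pos' (fun _ _ => Nat.zero_le _) ⟨y, by simp, ?_⟩
  rw [key, Nat.sub_self, binomParity_zero_left]
  norm_num

theorem innerCount_mersenne (h x z : ℕ) :
    (x % 2 ^ h + z % 2 ^ h + 1 = 2 ^ h → innerCount (2 ^ h - 1) x z = 1) ∧
      (2 ^ h ≤ x % 2 ^ h + z % 2 ^ h → innerCount (2 ^ h - 1) x z = 0) ∧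
      (x % 2 ^ h + z % 2 ^ h + 1 < 2 ^ h → innerCount (2 ^ h - 1) x z ≠ 1) := by
  induction h generalizing x z with
  | zero => simp [innerCount_zero, Nat.mod_one]
  | succ h ih =>
    have hp := Nat.one_le_two_pow (n := h)
    rw [mod_two_pow_succ, mod_two_pow_succ,
      show 2 ^ (h + 1) - 1 = 2 * (2 ^ h - 1) + 1 by omega, innerCount_odd]
    obtain ⟨h1, h2, h3⟩ := ih (x / 2) (z / 2)
    rw [pow_succ]
    rcases Nat.mod_two_eq_zero_or_one x with hx | hx <;>
      rcases Nat.mod_two_eq_zero_or_one z with hz | hz <;> rw [hx, hz] <;>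
      refine ⟨fun _ => ?_, fun _ => ?_, fun _ => ?_⟩ <;> omega

theorem innerCount_two_pow_sub_two (h x z : ℕ) :
    (x % 2 ^ (h + 1) + z % 2 ^ (h + 1) + 1 = 2 ^ (h + 1) ∨
      x % 2 ^ (h + 1) + z % 2 ^ (h + 1) = 2 ^ (h + 1) →
        innerCount (2 ^ (h + 1) - 2) x z = 1) ∧
      (1 ≤ h → innerCount (2 ^ (h + 1) - 2) x z = 1 →
        x % 2 ^ (h + 1) + z % 2 ^ (h + 1) + 1 = 2 ^ (h + 1) ∨
          x % 2 ^ (h + 1) + z % 2 ^ (h + 1) = 2 ^ (h + 1)) := by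
  induction h generalizing x z with
  | zero => simp [innerCount_zero]
  | succ h ih =>
    have hp := Nat.one_le_two_pow (n := h)
    rw [mod_two_pow_succ, mod_two_pow_succ z,
      show 2 ^ (h + 1 + 1) - 2 = 2 * (2 ^ (h + 1) - 2) + 2 by omega, innerCount_even,
      show 2 ^ (h + 1) - 2 + 1 = 2 ^ (h + 1) - 1 by omega]
    obtain ⟨h1, h2, h3⟩ := innerCount_mersenne (h + 1) (x / 2) (z / 2)
    obtain ⟨h4, h5⟩ := ih (x / 2) (z / 2)
    have h8 := innerCount_pos_of_mod_eq_zero (h + 1) (x / 2) (z / 2)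
      (y := 2 ^ (h + 1) - 1) (by omega)
    have h6 : h = 0 → innerCount (2 ^ (h + 1) - 2) (x / 2) (z / 2) = 1 := by
      rintro rfl
      simp [innerCount_zero]
    have h7 : h = 0 → 2 ^ h = 1 := by
      rintro rfl
      rfl
    have hu := Nat.mod_lt (x / 2) (Nat.two_pow_pos (h + 1))
    have hv := Nat.mod_lt (z / 2) (Nat.two_pow_pos (h + 1))
    rw [pow_succ _ (h + 1)]
    generalize innerCount (2 ^ (h + 1) - 2) (x / 2) (z / 2) = c at *
    generalize innerCount (2 ^ (h + 1) - 1) (x / 2) (z / 2) = d at *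
    generalize x / 2 % 2 ^ (h + 1) = u at *
    generalize z / 2 % 2 ^ (h + 1) = v at *
    rcases Nat.mod_two_eq_zero_or_one x with hx | hx <;>
      rcases Nat.mod_two_eq_zero_or_one z with hz | hz <;> rw [hx, hz] <;>
      refine ⟨fun _ => ?_, fun _ _ => ?_⟩ <;> omega

theorem exists_eq_two_mul_add_one {h a y : ℕ} (hh : 1 ≤ h)
    (hy : y + 1 + 2 ^ (a + 1) = 2 ^ (h + (a + 1))) :
    ∃ m, y = 2 * m + 1 ∧ m + 1 + 2 ^ a = 2 ^ (h + a) := by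
  rw [pow_succ, ← add_assoc, pow_succ] at hy
  have := Nat.pow_lt_pow_right (a := 2) (by norm_num) (show a < h + a by omega)
  exact ⟨(y - 1) / 2, by omega, by omega⟩

theorem innerCount_eq_one_iff {h : ℕ} (hh : 2 ≤ h) (a x z : ℕ) {y : ℕ}
    (hy : y + 1 + 2 ^ a = 2 ^ (h + a)) :
    innerCount y x z = 1 ↔
      x % 2 ^ (h + a) + z % 2 ^ (h + a) + 1 = 2 ^ (h + a) ∨
        x % 2 ^ (h + a) + z % 2 ^ (h + a) + 1 = 2 ^ (h + a) + 2 ^ a := by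
  induction a generalizing x z y with
  | zero =>
    obtain ⟨h, rfl⟩ := Nat.exists_eq_add_of_le' (show 1 ≤ h by omega)
    obtain ⟨h1, h2⟩ := innerCount_two_pow_sub_two h x z
    rw [pow_zero, add_zero] at *
    rw [show y = 2 ^ (h + 1) - 2 by omega]
    exact ⟨fun e => (h2 (by omega) e).imp id (by omega), fun e => h1 (e.imp id (by omega))⟩
  | succ a ih =>
    obtain ⟨m, rfl, hm'⟩ := exists_eq_two_mul_add_one (by omega) hy
    rw [← add_assoc, mod_two_pow_succ, mod_two_pow_succ z, pow_succ, pow_succ, innerCount_odd]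
    have hm := ih (x / 2) (z / 2) hm'
    have ha := Nat.one_le_two_pow (n := a)
    rcases Nat.mod_two_eq_zero_or_one x with hx | hx <;>
      rcases Nat.mod_two_eq_zero_or_one z with hz | hz <;> rw [hx, hz] <;> omega

/-! ### The antidiagonals `x + z = y` and `x + z = y + 1` -/

theorem binomParity_of_add_eq_mersenne (h : ℕ) {x z : ℕ} (hxz : x + z + 1 = 2 ^ h) :
    binomParity x z = 1 := by
  induction h generalizing x z with
  | zero =>
    obtain rfl : x = 0 := by rw [pow_zero] at hxz; omega
    exact binomParity_zero_left z
  | succ h ih =>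
    rw [pow_succ] at hxz
    rw [binomParity_halve, ih (x := x / 2) (z := z / 2) (by omega)]
    rcases Nat.mod_two_eq_zero_or_one x with hx | hx
    · simp [hx]
    · simp [show z % 2 = 0 by omega]

theorem binomParity_of_add_eq {h : ℕ} (hh : 1 ≤ h) (a : ℕ) {x z y : ℕ}
    (hy : y + 1 + 2 ^ a = 2 ^ (h + a)) (hxz : x + z = y) :
    binomParity x z = 1 ↔ x % 2 ^ (a + 1) < 2 ^ a := by
  induction a generalizing x z y with
  | zero =>
    obtain ⟨h, rfl⟩ := Nat.exists_eq_add_of_le' hh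
    rw [pow_zero, add_zero, pow_succ] at hy
    rw [binomParity_halve]
    rcases Nat.mod_two_eq_zero_or_one x with hx | hx
    · rw [binomParity_of_add_eq_mersenne h (x := x / 2) (z := z / 2) (by omega)]
      simp [hx]
    · simp [hx, show z % 2 = 1 by omega]
  | succ a ih =>
    obtain ⟨m, rfl, hm⟩ := exists_eq_two_mul_add_one hh hy
    have := ih (x := x / 2) (z := z / 2) hm (by omega)
    rw [mod_two_pow_succ, binomParity_halve]
    rcases Nat.mod_two_eq_zero_or_one x with hx | hx
    · rw [hx, zero_mul, Nat.sub_zero, one_mul]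
      rw [this, pow_succ _ a]
      omega
    · rw [show z % 2 = 0 by omega, mul_zero, Nat.sub_zero, one_mul]
      rw [this, pow_succ _ a]
      omega

theorem innerCount_of_add_eq {h : ℕ} (hh : 2 ≤ h) (a : ℕ) {x z y : ℕ}
    (hy : y + 1 + 2 ^ a = 2 ^ (h + a)) (hxz : x + z = y) (hb : binomParity x z = 1) :
    innerCount y x z = 2 := by
  induction a generalizing x z y with
  | zero =>
    obtain ⟨h, rfl⟩ := Nat.exists_eq_add_of_le' hh
    rw [pow_zero, add_zero, show h + 2 = h + 1 + 1 by rfl, pow_succ, pow_succ] at hy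
    have hp := Nat.one_le_two_pow (n := h)
    rw [binomParity_halve] at hb
    have hx : x % 2 = 0 := by
      by_contra hx
      rw [show x % 2 = 1 by omega, show z % 2 = 1 by omega] at hb
      simp at hb
    rw [show y = 2 * (2 ^ (h + 1) - 2) + 2 by omega, innerCount_even, hx,
      show z % 2 = 0 by omega]
    have hu : x / 2 % 2 ^ (h + 1) = x / 2 := Nat.mod_eq_of_lt (by omega)
    have hv : z / 2 % 2 ^ (h + 1) = z / 2 := Nat.mod_eq_of_lt (by omega)
    have h1 := (innerCount_mersenne (h + 1) (x / 2) (z / 2)).1 (by omega)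
    have h2 := (innerCount_two_pow_sub_two h (x / 2) (z / 2)).1 (by omega)
    rw [show 2 ^ (h + 1) - 2 + 1 = 2 ^ (h + 1) - 1 by omega, h1, h2]
  | succ a ih =>
    obtain ⟨m, rfl, hm⟩ := exists_eq_two_mul_add_one (by omega) hy
    rw [binomParity_halve] at hb
    rw [innerCount_odd, ih (x := x / 2) (z := z / 2) hm (by omega) (by
      exact Nat.eq_one_of_mul_eq_one_left hb)]
    omega

theorem binomParity_pred_of_innerCount_eq_zero {h : ℕ} (hh : 1 ≤ h) (a : ℕ) {x z y : ℕ}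
    (hy : y + 1 + 2 ^ a = 2 ^ (h + a)) (hxz : x + z = y + 1) (hx : 1 ≤ x)
    (hb : binomParity (x - 1) z = 1) (hc : innerCount y x z = 0) :
    1 ≤ z ∧ binomParity x (z - 1) = 1 := by
  induction a generalizing x z y with
  | zero =>
    obtain ⟨h, rfl⟩ := Nat.exists_eq_add_of_le' hh
    rw [pow_zero, add_zero] at hy
    have h1 := (innerCount_two_pow_sub_two h x z).1 (by
      rw [Nat.mod_eq_of_lt (show x < 2 ^ (h + 1) by omega),
        Nat.mod_eq_of_lt (show z < 2 ^ (h + 1) by omega)]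
      omega)
    rw [show y = 2 ^ (h + 1) - 2 by omega] at hc
    omega
  | succ a ih =>
    obtain ⟨m, rfl, hm⟩ := exists_eq_two_mul_add_one hh hy
    rw [binomParity_halve] at hb
    have hb' := Nat.eq_one_of_mul_eq_one_left hb
    rcases Nat.mod_two_eq_zero_or_one x with hx2 | hx2
    · rw [innerCount_odd, hx2, show z % 2 = 0 by omega] at hc
      rw [show (x - 1) / 2 = x / 2 - 1 by omega] at hb'
      obtain ⟨h1, h2⟩ := ih hm (x := x / 2) (z := z / 2) (by omega) (by omega) hb' (by omega)
      refine ⟨by omega, ?_⟩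
      rw [binomParity_halve, hx2, show (z - 1) / 2 = z / 2 - 1 by omega, h2]
      simp
    · refine ⟨by omega, ?_⟩
      rw [binomParity_halve, show (z - 1) % 2 = 0 by omega, show (z - 1) / 2 = z / 2 by omega,
        ← show (x - 1) / 2 = x / 2 by omega, hb']
      simp

theorem mod_pred_cases {x q : ℕ} (hq : 0 < q) (hx : 1 ≤ x) :
    1 ≤ x % q ∧ (x - 1) % q + 1 = x % q ∨ x % q = 0 ∧ (x - 1) % q + 1 = q := by
  obtain ⟨x, rfl⟩ := Nat.exists_eq_add_of_le' hx
  have h1 := Nat.mod_lt x hq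
  rw [Nat.add_sub_cancel, ← Nat.mod_add_mod]
  by_cases h2 : x % q + 1 = q
  · refine Or.inr ⟨?_, h2⟩
    rw [h2, Nat.mod_self]
  · refine Or.inl ?_
    rw [Nat.mod_eq_of_lt (show x % q + 1 < q by omega)]
    omega

theorem mem_ulamSet_iff_of_two_le {h a : ℕ} (hh : 2 ≤ h) (ha : 1 ≤ a) {y : ℕ}
    (hy : y + 1 + 2 ^ a = 2 ^ (h + a)) (x z : ℕ) :
    (x, z) ∈ UlamSet y ↔
      (x + z = y ∧ binomParity x z = 1) ∨
      x % 2 ^ (h + a) + z % 2 ^ (h + a) + 1 = 2 ^ (h + a) ∨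
      x % 2 ^ (h + a) + z % 2 ^ (h + a) + 1 = 2 ^ (h + a) + 2 ^ a := by
  classical
  induction hn : x + z using Nat.strong_induction_on generalizing x z with
  | _ n ih =>
    subst hn
    have hpa : 2 ≤ 2 ^ a := Nat.pow_le_pow_right (n := 2) (by norm_num) ha
    have hpq : 4 * 2 ^ a ≤ 2 ^ (h + a) := by
      rw [pow_add]
      exact Nat.mul_le_mul_right _ (Nat.pow_le_pow_right (n := 2) (by norm_num) hh)
    rw [mem_ulamSet_iff]
    have hA : 1 ≤ x ∧ (x - 1, z) ∈ UlamSet y ↔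
        1 ≤ x ∧ ((x - 1 + z = y ∧ binomParity (x - 1) z = 1) ∨
      (x - 1) % 2 ^ (h + a) + z % 2 ^ (h + a) + 1 = 2 ^ (h + a) ∨
      (x - 1) % 2 ^ (h + a) + z % 2 ^ (h + a) + 1 = 2 ^ (h + a) + 2 ^ a) :=
      and_congr_right fun hx => ih _ (by omega) _ _ rfl
    have hB : 1 ≤ z ∧ (x, z - 1) ∈ UlamSet y ↔
        1 ≤ z ∧ ((x + (z - 1) = y ∧ binomParity x (z - 1) = 1) ∨
      x % 2 ^ (h + a) + (z - 1) % 2 ^ (h + a) + 1 = 2 ^ (h + a) ∨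
      x % 2 ^ (h + a) + (z - 1) % 2 ^ (h + a) + 1 = 2 ^ (h + a) + 2 ^ a) :=
      and_congr_right fun hx => ih _ (by omega) _ _ rfl
    simp only [hA, hB]
    have hN := innerCount_eq_one_iff hh a x z hy
    have hE := innerCount_of_add_eq hh a (x := x) (z := z) hy
    have hP := binomParity_pred_of_innerCount_eq_zero (by omega) a (x := x) (z := z) hy
    have hQ := binomParity_pred_of_innerCount_eq_zero (by omega) a (x := z) (z := x) hy
    rw [innerCount_comm, binomParity_comm, binomParity_comm z] at hQ
    have hx0 := innerCount_pos_of_mod_eq_zero (h + a) x z (y := y) (by omega)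
    have hz0 := innerCount_pos_of_mod_eq_zero (h + a) z x (y := y) (by omega)
    rw [innerCount_comm] at hz0
    have hu' := mod_pred_cases (x := x) (Nat.two_pow_pos (h + a))
    have hv' := mod_pred_cases (x := z) (Nat.two_pow_pos (h + a))
    have hxq := Nat.mod_lt x (Nat.two_pow_pos (h + a))
    have hzq := Nat.mod_lt z (Nat.two_pow_pos (h + a))
    have hxl := Nat.mod_le x (2 ^ (h + a))
    have hzl := Nat.mod_le z (2 ^ (h + a))
    have hxs := Nat.mod_eq_of_lt (a := x) (b := 2 ^ (h + a))
    have hzs := Nat.mod_eq_of_lt (a := z) (b := 2 ^ (h + a))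
    have hb := binomParity_lt_two x z
    generalize innerCount y x z = c at *
    generalize (x - 1) % 2 ^ (h + a) = u' at *
    generalize (z - 1) % 2 ^ (h + a) = v' at *
    generalize x % 2 ^ (h + a) = u at *
    generalize z % 2 ^ (h + a) = v at *
    generalize 2 ^ (h + a) = q at *
    generalize 2 ^ a = p at *
    generalize binomParity x z = b at *
    generalize binomParity (x - 1) z = b1 at *
    generalize binomParity x (z - 1) = b2 at *
    clear hA hB ih
    by_cases h1 : x + z = y
    · obtain rfl := hxs (by omega)
      obtain rfl := hzs (by omega)
      clear hP hQ hx0 hz0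
      rw [if_neg (by clear hN hE; omega), if_neg (by clear hN hE; omega), if_pos h1]
      clear hu' hv'
      omega
    clear hE
    rw [if_neg h1, Nat.sub_zero]
    by_cases h2 : x + z = y + 1
    · obtain rfl := hxs (by omega)
      obtain rfl := hzs (by omega)
      have hA : (1 ≤ u ∧ ((u - 1 + v = y ∧ b1 = 1) ∨ u' + v + 1 = q ∨ u' + v + 1 = q + p)) ↔
          1 ≤ u ∧ b1 = 1 := by
        clear hP hQ hN hx0 hz0
        omega
      have hB : (1 ≤ v ∧ ((u + (v - 1) = y ∧ b2 = 1) ∨ u + v' + 1 = q ∨ u + v' + 1 = q + p)) ↔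
          1 ≤ v ∧ b2 = 1 := by
        clear hP hQ hN hx0 hz0
        omega
      simp only [hA, hB]
      clear hA hB hu' hv'
      have hc : c ≠ 1 := by
        clear hP hQ hx0 hz0
        omega
      have hF : ¬ ((u + v = y ∧ b = 1) ∨ u + v + 1 = q ∨ u + v + 1 = q + p) := by omega
      rw [iff_false_right hF]
      clear hN hF hxs hzs
      by_cases hA : 1 ≤ u ∧ b1 = 1 <;> by_cases hB : 1 ≤ v ∧ b2 = 1
      · rw [if_pos hA, if_pos hB]
        omega
      · rw [if_pos hA, if_neg hB]
        exact fun e => hB (hP h2 hA.1 hA.2 (by omega))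
      · rw [if_neg hA, if_pos hB]
        exact fun e => hA (hQ (by omega) hB.1 hB.2 (by omega))
      · rw [if_neg hA, if_neg hB]
        omega
    clear hP hQ hxs hzs hb
    have hA : (1 ≤ x ∧ ((x - 1 + z = y ∧ b1 = 1) ∨ u' + v + 1 = q ∨ u' + v + 1 = q + p)) ↔
        1 ≤ x ∧ (u' + v + 1 = q ∨ u' + v + 1 = q + p) := by
      clear hN hx0 hz0 hu' hv'
      omega
    have hB : (1 ≤ z ∧ ((x + (z - 1) = y ∧ b2 = 1) ∨ u + v' + 1 = q ∨ u + v' + 1 = q + p)) ↔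
        1 ≤ z ∧ (u + v' + 1 = q ∨ u + v' + 1 = q + p) := by
      clear hN hx0 hz0 hu' hv'
      omega
    simp only [hA, hB, h1, false_and, false_or]
    clear hA hB h1 h2
    rw [← hN]
    by_cases hA : 1 ≤ x ∧ (u' + v + 1 = q ∨ u' + v + 1 = q + p) <;>
      by_cases hB : 1 ≤ z ∧ (u + v' + 1 = q ∨ u + v' + 1 = q + p)
    · rw [if_pos hA, if_pos hB]
      omega
    · rw [if_pos hA, if_neg hB]
      omega
    · rw [if_neg hA, if_pos hB]
      omega
    · rw [if_neg hA, if_neg hB]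
      omega

/-- description of `Ulam[2^(k+1)-2^a-1]` for `0 < a < k`. -/
theorem ulamSet_zumkeller_general (k a : ℕ) (ha : 0 < a) (hak : a < k) (x z : ℕ) :
    (x, z) ∈ UlamSet (2 ^ (k + 1) - 2 ^ a - 1) ↔
      ((x + z = 2 ^ (k + 1) - 2 ^ a - 1 ∧ x % 2 ^ (a + 1) < 2 ^ a) ∨
       (x % 2 ^ (k + 1) + z % 2 ^ (k + 1) = 2 ^ (k + 1) - 1) ∨
       (x % 2 ^ (k + 1) + z % 2 ^ (k + 1) = 2 ^ (k + 1) + 2 ^ a - 1)) := by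
  have hap := Nat.one_le_two_pow (n := a)
  have hpq := Nat.pow_lt_pow_right (a := 2) (by norm_num) (show a < k + 1 by omega)
  have hka : k + 1 = (k + 1 - a) + a := by omega
  have hy : 2 ^ (k + 1) - 2 ^ a - 1 + 1 + 2 ^ a = 2 ^ (k + 1) := by omega
  rw [mem_ulamSet_iff_of_two_le (h := k + 1 - a) (by omega) ha (by rw [← hka, hy]), ← hka]
  refine or_congr (and_congr_right fun hxz => ?_) (by omega)
  exact binomParity_of_add_eq (h := k + 1 - a) (by omega) a (by rw [← hka, hy]) hxz
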